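/- Let 0 < d_m <= 1/(SA) and let M_{d_m} := { (mu, M) : min_{t,s,a} d_t^mu(s,a) >= d_m }, where M ranges over time-inhomogeneous H-horizon MDPs with S states, A actions and rewards in [0,1], and mu is a logging policy for M. Under the conditions H >= 2, A >= 2, 0 < eps < 1/(48 sqrt(8)) and S >= c1 (c1 a universal constant), there exist universal constants c and p > 0 such that whenever n <= c H^3 / (d_m eps^2), for every offline learning algorithm (any measurable map from n episodes generated by mu to an output policy pi_alg), sup_{(mu,M) in M_{d_m}} P_{mu,M}( v* - v^{pi_alg} >= eps ) >= p, where v* = max_pi v^pi is the optimal value of M. -/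

import Mathlib

open MeasureTheory Finset

noncomputable section

namespace OPE

/-- A finite, time-inhomogeneous episodic MDP (time indexed by `ℕ`; only times `< H` are used).
`P t s a s'` is the probability of transitioning from `(s, a)` at time `t` to state `s'` at
time `t+1`, `r t s a` is the mean reward, and `d₁` the initial state distribution. -/
structure MDP (S A : Type) [Fintype S] [Fintype A] where
  P : ℕ → S → A → S → ℝ
  P_nonneg : ∀ t s a s', 0 ≤ P t s a s'
  P_sum : ∀ t s a, ∑ s', P t s a s' = 1
  r : ℕ → S → A → ℝ
  r_nonneg : ∀ t s a, 0 ≤ r t s a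
  r_le_one : ∀ t s a, r t s a ≤ 1
  d₁ : S → ℝ
  d₁_nonneg : ∀ s, 0 ≤ d₁ s
  d₁_sum : ∑ s, d₁ s = 1

variable {S A : Type} [Fintype S] [Fintype A] [DecidableEq S] [DecidableEq A]
  [Inhabited S] [Inhabited A]

/-- A (possibly stochastic, non-stationary) policy. -/
def IsPolicy (π : ℕ → S → A → ℝ) : Prop :=
  (∀ t s a, 0 ≤ π t s a) ∧ ∀ t s, ∑ a, π t s a = 1

/-- The stochastic policy associated with a deterministic policy. -/
def detToPolicy (g : ℕ → S → A) : ℕ → S → A → ℝ := fun t s a => if a = g t s then 1 else 0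

/-- Marginal state-action distribution at time `t` under transitions `P`, initial state
distribution `d₁` and policy `π`. -/
def margDist (P : ℕ → S → A → S → ℝ) (d₁ : S → ℝ) (π : ℕ → S → A → ℝ) : ℕ → S × A → ℝ
  | 0 => fun q => d₁ q.1 * π 0 q.1 q.2
  | t + 1 => fun q => π (t + 1) q.1 q.2 * ∑ p : S × A, P t p.1 p.2 q.1 * margDist P d₁ π t p

/-- Value iteration with `k` steps to go, starting at time `t`. -/
def Vaux (P : ℕ → S → A → S → ℝ) (r : ℕ → S → A → ℝ) (π : ℕ → S → A → ℝ) : ℕ → ℕ → S → ℝ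
  | 0, _, _ => 0
  | k + 1, t, s => ∑ a, π t s a * (r t s a + ∑ s', P t s a s' * Vaux P r π k (t + 1) s')

/-- Value function `V_t^π` of policy `π` in the `H`-horizon MDP with transitions `P`,
mean rewards `r`. -/
def Vf (P : ℕ → S → A → S → ℝ) (r : ℕ → S → A → ℝ) (π : ℕ → S → A → ℝ) (H t : ℕ) :
    S → ℝ := Vaux P r π (H - t) t

/-- Q-function `Q_t^π`. -/
def Qf (P : ℕ → S → A → S → ℝ) (r : ℕ → S → A → ℝ) (π : ℕ → S → A → ℝ) (H t : ℕ) :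
    S → A → ℝ := fun s a => r t s a + ∑ s', P t s a s' * Vf P r π H (t + 1) s'

/-- The value `v^π = E_π[∑_{t<H} r_t]` of policy `π`. -/
def polValue (P : ℕ → S → A → S → ℝ) (r : ℕ → S → A → ℝ) (d₁ : S → ℝ)
    (π : ℕ → S → A → ℝ) (H : ℕ) : ℝ :=
  ∑ t ∈ Finset.range H, ∑ q : S × A, margDist P d₁ π t q * r t q.1 q.2

/-- Optimal value iteration. -/
def VstarAux (M : MDP S A) : ℕ → ℕ → S → ℝ
  | 0, _, _ => 0
  | k + 1, t, s => ⨆ a : A, (M.r t s a + ∑ s', M.P t s a s' * VstarAux M k (t + 1) s')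

/-- The optimal value `v* = max_π v^π`. -/
def vStar (M : MDP S A) (H : ℕ) : ℝ := ∑ s, M.d₁ s * VstarAux M H 0 s

/-- An episode: the state-action pairs and (random, real-valued) rewards at times `0, …, H-1`. -/
abbrev Episode (S A : Type) (H : ℕ) : Type := (Fin H → S × A) × (Fin H → ℝ)

/-- A dataset of `n` episodes. -/
abbrev Dataset (S A : Type) (H n : ℕ) : Type := Fin n → Episode S A H

/-- Safe access to the `t`-th entry of a path. -/
def pget {H : ℕ} (p : Fin H → S × A) (t : ℕ) : S × A := if h : t < H then p ⟨t, h⟩ else default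

/-- State-action pair of episode `e` at time `t`. -/
def esa {H : ℕ} (e : Episode S A H) (t : ℕ) : S × A := pget e.1 t

/-- Reward of episode `e` at time `t`. -/
def erew {H : ℕ} (e : Episode S A H) (t : ℕ) : ℝ := if h : t < H then e.2 ⟨t, h⟩ else 0

/-- Visitation count `n_{s,a}` at time `t`. -/
def cnt {H n : ℕ} (D : Dataset S A H n) (t : ℕ) (q : S × A) : ℕ :=
  (univ.filter fun i => esa (D i) t = q).card

/-- Count of transitions from `q` at time `t` to state `s'` at time `t+1`. -/
def cnt2 {H n : ℕ} (D : Dataset S A H n) (t : ℕ) (s' : S) (q : S × A) : ℕ :=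
  (univ.filter fun i => esa (D i) t = q ∧ (esa (D i) (t + 1)).1 = s').card

/-- Empirical transition kernel `P̂`. -/
def Phat {H n : ℕ} (D : Dataset S A H n) : ℕ → S → A → S → ℝ := fun t s a s' =>
  if cnt D t (s, a) = 0 then 0 else (cnt2 D t s' (s, a) : ℝ) / (cnt D t (s, a) : ℝ)

/-- Empirical mean reward `r̂`. -/
def rhat {H n : ℕ} (D : Dataset S A H n) : ℕ → S → A → ℝ := fun t s a =>
  if cnt D t (s, a) = 0 then 0
  else (∑ i, if esa (D i) t = (s, a) then erew (D i) t else 0) / (cnt D t (s, a) : ℝ)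

/-- Empirical initial state distribution. -/
def d1hat {H n : ℕ} (D : Dataset S A H n) : S → ℝ := fun s =>
  ((univ.filter fun i => (esa (D i) 0).1 = s).card : ℝ) / (n : ℝ)

/-- The OPEMA (model-based plug-in) estimator of `v^π`, built from the full dataset `D`. -/
def vhat {H n : ℕ} (D : Dataset S A H n) (π : ℕ → S → A → ℝ) : ℝ :=
  polValue (Phat D) (rhat D) (d1hat D) π H

/-- `N`: the minimum visitation count over all times `t < H` and all state-action pairs that are
accessible under the logging policy `μ`. -/
def Nmin {H n : ℕ} (M : MDP S A) (μ : ℕ → S → A → ℝ) (D : Dataset S A H n) : ℕ :=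
  sInf {k | ∃ t < H, ∃ q : S × A, 0 < margDist M.P M.d₁ μ t q ∧ cnt D t q = k}

/-- Number of episodes before `i` visiting `q` at time `t` (used to select the first `N`
transitions at each state-action pair). -/
def rankLt {H n : ℕ} (D : Dataset S A H n) (t : ℕ) (q : S × A) (i : Fin n) : ℕ :=
  (univ.filter fun j => j < i ∧ esa (D j) t = q).card

/-- Transition counts using only the first `N` visits to each state-action pair
(the sub-dataset `D'`). -/
def cnt2' {H n : ℕ} (D : Dataset S A H n) (N t : ℕ) (s' : S) (q : S × A) : ℕ :=
  (univ.filter fun i => esa (D i) t = q ∧ (esa (D i) (t + 1)).1 = s' ∧ rankLt D t q i < N).card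

/-- Empirical transition kernel built from the sub-dataset `D'`. -/
def Phat' {H n : ℕ} (D : Dataset S A H n) (N : ℕ) : ℕ → S → A → S → ℝ := fun t s a s' =>
  if N = 0 then 0 else (cnt2' D N t s' (s, a) : ℝ) / (N : ℝ)

/-- Empirical mean reward built from the sub-dataset `D'`. -/
def rhat' {H n : ℕ} (D : Dataset S A H n) (N : ℕ) : ℕ → S → A → ℝ := fun t s a =>
  if N = 0 then 0
  else (∑ i, if esa (D i) t = (s, a) ∧ rankLt D t (s, a) i < N then erew (D i) t else 0) / (N : ℝ)

/-- The OPEMA estimator built from the sub-dataset `D'`. -/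
def vhat' {H n : ℕ} (M : MDP S A) (μ : ℕ → S → A → ℝ) (D : Dataset S A H n)
    (π : ℕ → S → A → ℝ) : ℝ :=
  polValue (Phat' D (Nmin M μ D)) (rhat' D (Nmin M μ D)) (d1hat D) π H

/-- Fictitious transition kernel `P̃` (full dataset): equals `P̂` on the event
`E_t(s,a) = {n_{s,a} ≥ n d_t^μ(s,a)/2}` and the true `P` otherwise. -/
def Ptil {H n : ℕ} (M : MDP S A) (μ : ℕ → S → A → ℝ) (D : Dataset S A H n) :
    ℕ → S → A → S → ℝ := fun t s a s' =>
  if (n : ℝ) * margDist M.P M.d₁ μ t (s, a) / 2 ≤ (cnt D t (s, a) : ℝ) then Phat D t s a s'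
  else M.P t s a s'

/-- Fictitious mean reward `r̃` (full dataset). -/
def rtil {H n : ℕ} (M : MDP S A) (μ : ℕ → S → A → ℝ) (D : Dataset S A H n) :
    ℕ → S → A → ℝ := fun t s a =>
  if (n : ℝ) * margDist M.P M.d₁ μ t (s, a) / 2 ≤ (cnt D t (s, a) : ℝ) then rhat D t s a
  else M.r t s a

/-- Fictitious marginal state-action distribution `d̃_t^π` (full dataset). -/
def dtil {H n : ℕ} (M : MDP S A) (μ : ℕ → S → A → ℝ) (D : Dataset S A H n)
    (π : ℕ → S → A → ℝ) : ℕ → S × A → ℝ :=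
  margDist (Ptil M μ D) (d1hat D) π

/-- Fictitious transition kernel built from the sub-dataset `D'`: equals the `D'`-based
empirical kernel on the event `E = {N ≥ n d_m/2}` and the true `P` otherwise. -/
def Ptil' {H n : ℕ} (M : MDP S A) (μ : ℕ → S → A → ℝ) (dm : ℝ) (D : Dataset S A H n) :
    ℕ → S → A → S → ℝ := fun t s a s' =>
  if (n : ℝ) * dm / 2 ≤ (Nmin M μ D : ℝ) then Phat' D (Nmin M μ D) t s a s' else M.P t s a s'

/-- Fictitious marginal state-action distribution built from the sub-dataset `D'`. -/
def dtil' {H n : ℕ} (M : MDP S A) (μ : ℕ → S → A → ℝ) (dm : ℝ) (D : Dataset S A H n)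
    (π : ℕ → S → A → ℝ) : ℕ → S × A → ℝ :=
  margDist (Ptil' M μ dm D) (d1hat D) π

/-- `dm` is a positive lower bound for all positive marginal state-action occupancies of the
logging policy `μ` (i.e. `dm ≤ d_m := min{d_t^μ(s,a) : d_t^μ(s,a) > 0}`). -/
def DmLB (M : MDP S A) (μ : ℕ → S → A → ℝ) (H : ℕ) (dm : ℝ) : Prop :=
  0 < dm ∧ ∀ t < H, ∀ q : S × A, 0 < margDist M.P M.d₁ μ t q → dm ≤ margDist M.P M.d₁ μ t q

/-- Assumption 2 (exploration requirement): the logging policy `μ` visits every accessible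
state with positive probability. -/
def Explores (M : MDP S A) (μ : ℕ → S → A → ℝ) (H : ℕ) : Prop :=
  ∀ t < H, ∀ s : S,
    (∃ π, IsPolicy π ∧ 0 < ∑ a, margDist M.P M.d₁ π t (s, a)) →
    0 < ∑ a, margDist M.P M.d₁ μ t (s, a)

section Law

variable [MeasurableSpace S] [MeasurableSpace A]

/-- Probability of a state-action path under the logging policy `μ`. -/
def pathWeight (M : MDP S A) (μ : ℕ → S → A → ℝ) {H : ℕ} (p : Fin H → S × A) : ℝ :=
  (M.d₁ (pget p 0).1 * μ 0 (pget p 0).1 (pget p 0).2) *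
    ∏ t ∈ Finset.range (H - 1),
      (M.P t (pget p t).1 (pget p t).2 (pget p (t + 1)).1 *
        μ (t + 1) (pget p (t + 1)).1 (pget p (t + 1)).2)

/-- The law of a single episode generated by the logging policy `μ` in the MDP `M`, with reward
distributions `R t s a` (supported on `[0,1]` with mean `M.r t s a`). -/
def episodeLaw (M : MDP S A) (μ : ℕ → S → A → ℝ) (R : ℕ → S → A → Measure ℝ) (H : ℕ) :
    Measure (Episode S A H) :=
  ∑ p : Fin H → S × A,
    ENNReal.ofReal (pathWeight M μ p) •
      ((Measure.dirac p).prod (Measure.pi fun t : Fin H => R (t : ℕ) (p t).1 (p t).2))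

/-- The law of a dataset of `n` i.i.d. episodes generated by `μ` in `M`. -/
def datasetLaw (M : MDP S A) (μ : ℕ → S → A → ℝ) (R : ℕ → S → A → Measure ℝ) (H n : ℕ) :
    Measure (Dataset S A H n) :=
  Measure.pi fun _ : Fin n => episodeLaw M μ R H

/-- The reward distributions `R` are probability measures supported on `[0,1]` whose means are
the mean rewards of `M`. -/
def ValidReward (M : MDP S A) (R : ℕ → S → A → Measure ℝ) : Prop :=
  ∀ t s a, IsProbabilityMeasure (R t s a) ∧ (R t s a) (Set.Icc (0 : ℝ) 1)ᶜ = 0 ∧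
    (∫ x, x ∂(R t s a)) = M.r t s a

end Law

end OPE

namespace OPE

section Generic

variable {S A : Type} [Fintype S] [Fintype A]

/-- Marginal state distribution at time `t` under transitions `P`, initial state distribution
`d₁` and policy `π`. -/
def stateDist (P : ℕ → S → A → S → ℝ) (d₁ : S → ℝ) (π : ℕ → S → A → ℝ) : ℕ → S → ℝ
  | 0 => d₁
  | t + 1 => fun s' => ∑ s, stateDist P d₁ π t s * ∑ a, π t s a * P t s a s'

lemma margDist_eq_mul_stateDist (P : ℕ → S → A → S → ℝ) (d₁ : S → ℝ) (π : ℕ → S → A → ℝ)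
    (t : ℕ) (q : S × A) :
    margDist P d₁ π t q = π t q.1 q.2 * stateDist P d₁ π t q.1 := by
  induction t generalizing q with
  | zero => simp [margDist, stateDist, mul_comm]
  | succ t ih =>
    simp only [margDist, stateDist, Fintype.sum_prod_type, ih, Finset.mul_sum]
    refine Finset.sum_congr rfl fun s _ => Finset.sum_congr rfl fun a _ => ?_
    ring

lemma stateDist_nonneg (M : MDP S A) {π : ℕ → S → A → ℝ} (hπ : IsPolicy π) (t : ℕ) (s : S) :
    0 ≤ stateDist M.P M.d₁ π t s := by
  induction t generalizing s with
  | zero => exact M.d₁_nonneg s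
  | succ t ih =>
    exact Finset.sum_nonneg fun s' _ => mul_nonneg (ih s') <| Finset.sum_nonneg fun a _ =>
      mul_nonneg (hπ.1 t s' a) (M.P_nonneg t s' a s)

lemma sum_stateDist_succ_mul (P : ℕ → S → A → S → ℝ) (d₁ : S → ℝ) (π : ℕ → S → A → ℝ)
    (t : ℕ) (f : S → ℝ) :
    ∑ s', stateDist P d₁ π (t + 1) s' * f s' =
      ∑ s, stateDist P d₁ π t s * ∑ a, π t s a * ∑ s', P t s a s' * f s' := by
  simp only [stateDist, Finset.sum_mul, Finset.mul_sum]
  rw [Finset.sum_comm]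
  refine Finset.sum_congr rfl fun s _ => ?_
  rw [Finset.sum_comm]
  refine Finset.sum_congr rfl fun a _ => Finset.sum_congr rfl fun s' _ => ?_
  ring

lemma sum_stateDist_succ (P : ℕ → S → A → S → ℝ) (d₁ : S → ℝ) (π : ℕ → S → A → ℝ) (t : ℕ) :
    ∑ s', stateDist P d₁ π (t + 1) s' =
      ∑ s, stateDist P d₁ π t s * ∑ a, π t s a * ∑ s', P t s a s' := by
  simpa using sum_stateDist_succ_mul P d₁ π t fun _ => 1

lemma sum_margDist (P : ℕ → S → A → S → ℝ) (d₁ : S → ℝ) {π : ℕ → S → A → ℝ}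
    (hπ : IsPolicy π) (t : ℕ) :
    ∑ q, margDist P d₁ π t q = ∑ s, stateDist P d₁ π t s := by
  simp only [margDist_eq_mul_stateDist, Fintype.sum_prod_type, ← Finset.sum_mul, hπ.2, one_mul]

lemma sum_stateDist (M : MDP S A) {π : ℕ → S → A → ℝ} (hπ : IsPolicy π) (t : ℕ) :
    ∑ s, stateDist M.P M.d₁ π t s = 1 := by
  induction t with
  | zero => exact M.d₁_sum
  | succ t ih => simp [sum_stateDist_succ, M.P_sum, hπ.2, ih]

lemma polValue_eq (P : ℕ → S → A → S → ℝ) (r : ℕ → S → A → ℝ) (d₁ : S → ℝ)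
    (π : ℕ → S → A → ℝ) (H : ℕ) :
    polValue P r d₁ π H =
      ∑ t ∈ Finset.range H, ∑ s, stateDist P d₁ π t s * ∑ a, π t s a * r t s a := by
  simp only [polValue, margDist_eq_mul_stateDist, Fintype.sum_prod_type, Finset.mul_sum]
  refine Finset.sum_congr rfl fun t _ => Finset.sum_congr rfl fun s _ =>
    Finset.sum_congr rfl fun a _ => ?_
  ring

lemma sum_policy_mul_le_VstarAux (M : MDP S A) {π : ℕ → S → A → ℝ} (hπ : IsPolicy π)
    (k t : ℕ) (s : S) :
    ∑ a, π t s a * (M.r t s a + ∑ s', M.P t s a s' * VstarAux M k (t + 1) s') ≤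
      VstarAux M (k + 1) t s := by
  calc
    _ ≤ ∑ a, π t s a * VstarAux M (k + 1) t s :=
        Finset.sum_le_sum fun a _ => mul_le_mul_of_nonneg_left
          (le_ciSup (f := fun a => M.r t s a + ∑ s', M.P t s a s' * VstarAux M k (t + 1) s')
            (Set.finite_range _).bddAbove a) (hπ.1 t s a)
    _ = VstarAux M (k + 1) t s := by rw [← Finset.sum_mul, hπ.2, one_mul]

/-- The optimal value dominates the value of every policy. -/
lemma polValue_le_vStar (M : MDP S A) {π : ℕ → S → A → ℝ} (hπ : IsPolicy π) (H : ℕ) :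
    polValue M.P M.r M.d₁ π H ≤ vStar M H := by
  have key : ∀ k m, m + k = H →
      (∑ t ∈ Finset.range m, ∑ s, stateDist M.P M.d₁ π t s * ∑ a, π t s a * M.r t s a) +
        ∑ s, stateDist M.P M.d₁ π m s * VstarAux M k m s ≤ vStar M H := by
    intro k m hm
    induction m generalizing k with
    | zero =>
      obtain rfl : k = H := by omega
      simp [vStar, stateDist]
    | succ m ih =>
      refine le_trans ?_ (ih (k + 1) (by omega))
      rw [Finset.sum_range_succ, add_assoc, sum_stateDist_succ_mul, ← Finset.sum_add_distrib]
      gcongr with s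
      rw [← mul_add, ← Finset.sum_add_distrib]
      simp only [← mul_add]
      exact mul_le_mul_of_nonneg_left (sum_policy_mul_le_VstarAux M hπ k m s)
        (stateDist_nonneg M hπ m s)
  simpa [polValue_eq, VstarAux] using key 0 H rfl

/-- The weight of a state-action path under a transition function `P` that need not be
stochastic. -/
def kernelPathWeight [Inhabited S] [Inhabited A]
    (P : ℕ → S → A → S → ℝ) (d₁ : S → ℝ)
    (π : ℕ → S → A → ℝ) {H : ℕ} (p : Fin H → S × A) : ℝ :=
  (d₁ (pget p 0).1 * π 0 (pget p 0).1 (pget p 0).2) *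
    ∏ t ∈ Finset.range (H - 1),
      (P t (pget p t).1 (pget p t).2 (pget p (t + 1)).1 *
        π (t + 1) (pget p (t + 1)).1 (pget p (t + 1)).2)

lemma pget_snoc_of_lt {S A : Type} [Inhabited S] [Inhabited A] {H : ℕ} (p : Fin H → S × A)
    (q : S × A) {t : ℕ}
    (ht : t < H) : pget (Fin.snoc p q : Fin (H + 1) → S × A) t = pget p t := by
  have h : (⟨t, by omega⟩ : Fin (H + 1)) = Fin.castSucc ⟨t, ht⟩ := rfl
  rw [pget, pget, dif_pos (by omega), dif_pos ht, h, Fin.snoc_castSucc]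

lemma pget_snoc_self {S A : Type} [Inhabited S] [Inhabited A] {H : ℕ} (p : Fin H → S × A)
    (q : S × A) :
    pget (Fin.snoc p q : Fin (H + 1) → S × A) H = q := by
  have h : (⟨H, by omega⟩ : Fin (H + 1)) = Fin.last H := rfl
  rw [pget, dif_pos (by omega), h, Fin.snoc_last]

lemma kernelPathWeight_snoc {S A : Type} [Inhabited S] [Inhabited A]
    (P : ℕ → S → A → S → ℝ) (d₁ : S → ℝ)
    (π : ℕ → S → A → ℝ) {H : ℕ} (p : Fin (H + 1) → S × A) (q : S × A) :
    kernelPathWeight P d₁ π (Fin.snoc p q : Fin (H + 1 + 1) → S × A) =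
      kernelPathWeight P d₁ π p *
        (P H (pget p H).1 (pget p H).2 q.1 * π (H + 1) q.1 q.2) := by
  simp only [kernelPathWeight, Nat.add_sub_cancel]
  rw [Finset.prod_range_succ, pget_snoc_of_lt p q (Nat.succ_pos H),
    pget_snoc_of_lt p q (Nat.lt_succ_self H), pget_snoc_self, ← mul_assoc]
  congr 2
  refine Finset.prod_congr rfl fun t ht => ?_
  have ht := Finset.mem_range.1 ht
  rw [pget_snoc_of_lt p q (by omega), pget_snoc_of_lt p q (by omega)]

lemma sum_kernelPathWeight_mul [Inhabited S] [Inhabited A]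
    (P : ℕ → S → A → S → ℝ) (d₁ : S → ℝ)
    (π : ℕ → S → A → ℝ) (H : ℕ) (f : S × A → ℝ) :
    ∑ p : Fin (H + 1) → S × A, kernelPathWeight P d₁ π p * f (pget p H) =
      ∑ q, margDist P d₁ π H q * f q := by
  induction H generalizing f with
  | zero =>
    rw [← (Equiv.funUnique (Fin 1) (S × A)).symm.sum_comp]
    simp [kernelPathWeight, pget, margDist]
  | succ H ih =>
    rw [← (Fin.snocEquiv fun _ : Fin (H + 1 + 1) => S × A).sum_comp, Fintype.sum_prod_type]
    refine Finset.sum_congr rfl fun q _ => ?_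
    have h := ih fun x => P H x.1 x.2 q.1 * π (H + 1) q.1 q.2 * f q
    simp only [Fin.snocEquiv, Equiv.coe_fn_mk]
    calc
      _ = _ := Finset.sum_congr rfl fun p _ => by
        rw [kernelPathWeight_snoc, pget_snoc_self, mul_assoc]
      _ = _ := h
      _ = _ := by
        simp only [margDist, Finset.mul_sum, Finset.sum_mul]
        exact Finset.sum_congr rfl fun x _ => by ring

lemma sum_kernelPathWeight [Inhabited S] [Inhabited A]
    (P : ℕ → S → A → S → ℝ) (d₁ : S → ℝ)
    {π : ℕ → S → A → ℝ} (hπ : IsPolicy π) (H : ℕ) :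
    ∑ p : Fin (H + 1) → S × A, kernelPathWeight P d₁ π p = ∑ s, stateDist P d₁ π H s := by
  simpa [sum_margDist P d₁ hπ] using sum_kernelPathWeight_mul P d₁ π H fun _ => 1

lemma pathWeight_nonneg [Inhabited S] [Inhabited A] (M : MDP S A) {π : ℕ → S → A → ℝ}
    (hπ : IsPolicy π) {H : ℕ} (p : Fin H → S × A) : 0 ≤ pathWeight M π p :=
  mul_nonneg (mul_nonneg (M.d₁_nonneg _) (hπ.1 _ _ _)) <| Finset.prod_nonneg fun _ _ =>
    mul_nonneg (M.P_nonneg _ _ _ _) (hπ.1 _ _ _)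

lemma sum_pathWeight [Inhabited S] [Inhabited A] (M : MDP S A) {π : ℕ → S → A → ℝ}
    (hπ : IsPolicy π) {H : ℕ} (hH : 0 < H) : ∑ p : Fin H → S × A, pathWeight M π p = 1 := by
  obtain ⟨H, rfl⟩ := Nat.exists_eq_succ_of_ne_zero hH.ne'
  exact (sum_kernelPathWeight M.P M.d₁ hπ H).trans (sum_stateDist M hπ H)

lemma sqrt_mul_pathWeight [Inhabited S] [Inhabited A] (M M' : MDP S A) (hd : M'.d₁ = M.d₁)
    {π : ℕ → S → A → ℝ} (hπ : IsPolicy π) {H : ℕ} (p : Fin H → S × A) :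
    √(pathWeight M π p * pathWeight M' π p) =
      kernelPathWeight (fun t s a s' => √(M.P t s a s' * M'.P t s a s')) M.d₁ π p := by
  rw [Real.sqrt_eq_iff_mul_self_eq
    (mul_nonneg (pathWeight_nonneg M hπ p) (pathWeight_nonneg M' hπ p))]
  · simp only [kernelPathWeight, pathWeight, hd]
    rw [mul_mul_mul_comm, mul_mul_mul_comm _ _ (M.d₁ _ * _), ← Finset.prod_mul_distrib,
      ← Finset.prod_mul_distrib]
    congr 1
    refine Finset.prod_congr rfl fun t _ => ?_
    rw [mul_mul_mul_comm, mul_mul_mul_comm (√_),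
      Real.mul_self_sqrt (mul_nonneg (M.P_nonneg _ _ _ _) (M'.P_nonneg _ _ _ _))]
  · exact mul_nonneg (mul_nonneg (M.d₁_nonneg _) (hπ.1 _ _ _)) <| Finset.prod_nonneg fun _ _ =>
      mul_nonneg (Real.sqrt_nonneg _) (hπ.1 _ _ _)

/-- If two MDPs differ only in their transitions at time `t₀`, the total mass of the geometric
mean of their path weights is determined by the transitions at time `t₀`. -/
lemma sum_sqrt_mul_pathWeight [Inhabited S] [Inhabited A] (M M' : MDP S A) (hd : M'.d₁ = M.d₁)
    {t₀ : ℕ} (hP : ∀ t, t ≠ t₀ → M'.P t = M.P t)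
    {π : ℕ → S → A → ℝ} (hπ : IsPolicy π) {H : ℕ} (hH : t₀ + 1 < H) :
    ∑ p : Fin H → S × A, √(pathWeight M π p * pathWeight M' π p) =
      ∑ s, stateDist M.P M.d₁ π t₀ s *
        ∑ a, π t₀ s a * ∑ s', √(M.P t₀ s a s' * M'.P t₀ s a s') := by
  obtain ⟨H, rfl⟩ := Nat.exists_eq_succ_of_ne_zero (by omega : H ≠ 0)
  simp only [sqrt_mul_pathWeight M M' hd hπ]
  rw [sum_kernelPathWeight _ _ hπ]
  set Q : ℕ → S → A → S → ℝ := fun t s a s' => √(M.P t s a s' * M'.P t s a s') with hQ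
  have hQP : ∀ t, t ≠ t₀ → Q t = M.P t := by
    intro t ht
    funext s a s'
    simp only [hQ, hP t ht, Real.sqrt_mul_self (M.P_nonneg t s a s')]
  have hbefore : ∀ t ≤ t₀, stateDist Q M.d₁ π t = stateDist M.P M.d₁ π t := by
    intro t ht
    induction t with
    | zero => rfl
    | succ t ih => simp only [stateDist, ih (by omega), hQP t (by omega)]
  have hafter : ∀ t, t₀ + 1 ≤ t →
      ∑ s, stateDist Q M.d₁ π t s = ∑ s, stateDist Q M.d₁ π (t₀ + 1) s := by
    intro t ht
    induction t, ht using Nat.le_induction with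
    | base => rfl
    | succ t ht ih =>
      rw [sum_stateDist_succ, hQP t (by omega)]
      simp [M.P_sum, hπ.2, ih]
  rw [hafter H (by omega), sum_stateDist_succ, hbefore t₀ le_rfl]

end Generic

section DatasetLaw
variable {S A : Type} [Fintype S] [Fintype A] [Inhabited S] [Inhabited A]
  [MeasurableSpace S] [MeasurableSpace A] [MeasurableSingletonClass S] [MeasurableSingletonClass A]

/-- The dataset with state-action paths `p` in which every reward equals its mean. -/
def meanRewardDataset (r : ℕ → S → A → ℝ) {H n : ℕ} (p : Fin n → Fin H → S × A) :
    Dataset S A H n :=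
  fun i => (p i, fun t => r t (p i t).1 (p i t).2)

/-- With deterministic rewards, the probability of an event is at least the total weight of the
path families whose datasets belong to it. -/
lemma sum_prod_pathWeight_le_datasetLaw (M : MDP S A) {μ : ℕ → S → A → ℝ} (H n : ℕ)
    (hw : ∀ p : Fin H → S × A, 0 ≤ pathWeight M μ p) (E : Set (Dataset S A H n))
    (F : Finset (Fin n → Fin H → S × A)) (hF : ∀ p ∈ F, meanRewardDataset M.r p ∈ E) :
    ENNReal.ofReal (∑ p ∈ F, ∏ i, pathWeight M μ (p i)) ≤
      datasetLaw M μ (fun t s a => Measure.dirac (M.r t s a)) H n E := by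
  classical
  set R : ℕ → S → A → Measure ℝ := fun t s a => Measure.dirac (M.r t s a)
  have hfin : IsFiniteMeasure (episodeLaw M μ R H) := by
    refine ⟨?_⟩
    simp only [episodeLaw, Measure.coe_finsetSum, Finset.sum_apply, Measure.smul_apply,
      smul_eq_mul]
    exact ENNReal.sum_lt_top.2 fun p _ => ENNReal.mul_lt_top ENNReal.ofReal_lt_top
      (measure_lt_top _ _)
  have hep : ∀ p : Fin H → S × A, ENNReal.ofReal (pathWeight M μ p) ≤
      episodeLaw M μ R H {(p, fun t : Fin H => M.r t (p t).1 (p t).2)} := by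
    intro p
    simp only [episodeLaw, Measure.coe_finsetSum, Finset.sum_apply, Measure.smul_apply,
      smul_eq_mul]
    refine le_trans (le_of_eq ?_) (Finset.single_le_sum (fun _ _ => zero_le) (Finset.mem_univ p))
    rw [← Set.singleton_prod_singleton, Measure.prod_prod, Measure.pi_singleton]
    simp [R]
  have hinj : Function.Injective
      (meanRewardDataset M.r : (Fin n → Fin H → S × A) → Dataset S A H n) := by
    intro p p' h
    funext i
    exact congrArg Prod.fst (congrFun h i)
  calc
    ENNReal.ofReal (∑ p ∈ F, ∏ i, pathWeight M μ (p i))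
      = ∑ p ∈ F, ∏ i, ENNReal.ofReal (pathWeight M μ (p i)) := by
        rw [ENNReal.ofReal_sum_of_nonneg fun p _ => Finset.prod_nonneg fun i _ => hw _]
        exact Finset.sum_congr rfl fun p _ => ENNReal.ofReal_prod_of_nonneg fun i _ => hw _
    _ ≤ ∑ p ∈ F, datasetLaw M μ R H n {meanRewardDataset M.r p} := by
        refine Finset.sum_le_sum fun p _ => ?_
        rw [datasetLaw, Measure.pi_singleton]
        exact Finset.prod_le_prod' fun i _ => hep (p i)
    _ = datasetLaw M μ R H n (F.map ⟨_, hinj⟩ : Finset (Dataset S A H n)) := by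
        rw [← sum_measure_singleton, Finset.sum_map]
        rfl
    _ ≤ datasetLaw M μ R H n E := by
        refine measure_mono fun D hD => ?_
        obtain ⟨p, hp, rfl⟩ := Finset.mem_map.1 (Finset.mem_coe.1 hD)
        exact hF p hp

end DatasetLaw

lemma validReward_dirac {S A : Type} [Fintype S] [Fintype A] (M : MDP S A) :
    ValidReward M fun t s a => Measure.dirac (M.r t s a) := by
  refine fun t s a => ⟨inferInstance, ?_, by simp⟩
  rw [Measure.dirac_apply' _ measurableSet_Icc.compl]
  simp [M.r_nonneg, M.r_le_one]

/-- Le Cam's inequality between the overlap and the Bhattacharyya coefficient of two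
probability weights. -/
lemma sq_sum_sqrt_le_two_mul_sum_min {Ω : Type*} [Fintype Ω] (P Q : Ω → ℝ) (hP : ∀ ω, 0 ≤ P ω)
    (hQ : ∀ ω, 0 ≤ Q ω) (hP1 : ∑ ω, P ω = 1) (hQ1 : ∑ ω, Q ω = 1) :
    (∑ ω, √(P ω * Q ω)) ^ 2 ≤ 2 * ∑ ω, min (P ω) (Q ω) := by
  have hmin : ∀ ω, 0 ≤ min (P ω) (Q ω) := fun ω => le_min (hP ω) (hQ ω)
  have hmax : ∑ ω, max (P ω) (Q ω) ≤ 2 := by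
    calc
      _ ≤ ∑ ω, (P ω + Q ω) := Finset.sum_le_sum fun ω _ =>
          max_le (by linarith [hQ ω]) (by linarith [hP ω])
      _ = 2 := by rw [Finset.sum_add_distrib, hP1, hQ1]; norm_num
  calc
    _ = (∑ ω, √(min (P ω) (Q ω)) * √(max (P ω) (Q ω))) ^ 2 := by
      congr 1
      exact Finset.sum_congr rfl fun ω _ => by rw [← Real.sqrt_mul (hmin ω), min_mul_max]
    _ ≤ (∑ ω, √(min (P ω) (Q ω)) ^ 2) * ∑ ω, √(max (P ω) (Q ω)) ^ 2 :=
      Finset.sum_mul_sq_le_sq_mul_sq _ _ _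
    _ = (∑ ω, min (P ω) (Q ω)) * ∑ ω, max (P ω) (Q ω) := by
      congr 1 <;> refine Finset.sum_congr rfl fun ω _ => Real.sq_sqrt ?_
      · exact hmin ω
      · exact (hP ω).trans (le_max_left _ _)
    _ ≤ _ := by
      rw [mul_comm]
      exact mul_le_mul_of_nonneg_right hmax (Finset.sum_nonneg fun ω _ => hmin ω)

lemma sum_prod_sqrt {X : Type*} [Fintype X] (n : ℕ) (P Q : X → ℝ) (hP : ∀ x, 0 ≤ P x)
    (hQ : ∀ x, 0 ≤ Q x) :
    ∑ p : Fin n → X, √((∏ i, P (p i)) * ∏ i, Q (p i)) = (∑ x, √(P x * Q x)) ^ n := by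
  rw [Fintype.sum_pow]
  refine Finset.sum_congr rfl fun p _ => ?_
  rw [← Finset.prod_mul_distrib, Real.sqrt_eq_iff_mul_self_eq, ← Finset.prod_mul_distrib]
  · exact Finset.prod_congr rfl fun i _ =>
      (Real.mul_self_sqrt (mul_nonneg (hP _) (hQ _))).symm
  · exact Finset.prod_nonneg fun i _ => mul_nonneg (hP _) (hQ _)
  · exact Finset.prod_nonneg fun i _ => Real.sqrt_nonneg _

/-- The sign `±1` encoded by a Boolean. -/
def boolSign (b : Bool) : ℝ := if b then 1 else -1

lemma boolSign_not (b : Bool) : boolSign (!b) = -boolSign b := by cases b <;> simp [boolSign]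

lemma boolSign_mul_self (b : Bool) : boolSign b * boolSign b = 1 := by
  cases b <;> simp [boolSign]

lemma abs_boolSign (b : Bool) : |boolSign b| = 1 := by cases b <;> simp [boolSign]

/-- Flip the `i`-th coordinate of a Boolean vector. -/
def flipCoord {I : Type*} [DecidableEq I] (i : I) (v : I → Bool) : I → Bool :=
  Function.update v i (!v i)

lemma flipCoord_self {I : Type*} [DecidableEq I] (i : I) (v : I → Bool) :
    flipCoord i v i = !v i := by simp [flipCoord]

lemma flipCoord_involutive {I : Type*} [DecidableEq I] (i : I) :
    Function.Involutive (flipCoord i) := by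
  intro v
  simp [flipCoord]

/-- Assouad's lemma, in probability: if neighbouring vertices of the hypercube have overlap at
least `β`, then under some vertex `v` the weighted loss exceeds a fraction `η` of its total
weight with probability at least `(β - η) / 2`. -/
lemma assouad {I Ω : Type*} [Fintype I] [DecidableEq I] [Fintype Ω]
    (W : (I → Bool) → Ω → ℝ) (hW : ∀ v ω, 0 ≤ W v ω) (hW1 : ∀ v, ∑ ω, W v ω = 1)
    (x : Ω → I → ℝ) (hx : ∀ ω i, |x ω i| ≤ 1) (c : I → ℝ) (hc : ∀ i, 0 ≤ c i)
    (hc0 : 0 < ∑ i, c i) {β η : ℝ} (hη : 0 ≤ η)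
    (hβ : ∀ v i, β ≤ ∑ ω, min (W v ω) (W (flipCoord i v) ω)) :
    ∃ v, (β - η) / 2 ≤
      ∑ ω with η * ∑ i, c i ≤ ∑ i, c i * (1 - boolSign (v i) * x ω i), W v ω := by
  have hpt : ∀ (v : I → Bool) i ω, boolSign (v i) * x ω i ≤ 1 ∧ -1 ≤ boolSign (v i) * x ω i := by
    intro v i ω
    have h : |boolSign (v i) * x ω i| ≤ 1 := by simpa [abs_mul, abs_boolSign] using hx ω i
    exact ⟨(abs_le.1 h).2, (abs_le.1 h).1⟩
  have hcoord : ∀ i, (Fintype.card (I → Bool) : ℝ) * β ≤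
      ∑ v, ∑ ω, W v ω * (1 - boolSign (v i) * x ω i) := by
    intro i
    have hflip : ∑ v, ∑ ω, W v ω * (1 - boolSign (v i) * x ω i) =
        ∑ v, ∑ ω, W (flipCoord i v) ω * (1 + boolSign (v i) * x ω i) := by
      rw [← Equiv.sum_comp (flipCoord_involutive i).toPerm]
      refine Finset.sum_congr rfl fun v _ => Finset.sum_congr rfl fun ω _ => ?_
      simp only [Function.Involutive.coe_toPerm, flipCoord_self, boolSign_not]
      ring
    have hsum : ∑ v : I → Bool, 2 * β ≤
        ∑ v, ∑ ω, W v ω * (1 - boolSign (v i) * x ω i) +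
        ∑ v, ∑ ω, W (flipCoord i v) ω * (1 + boolSign (v i) * x ω i) := by
      rw [← Finset.sum_add_distrib]
      refine Finset.sum_le_sum fun v _ => ?_
      rw [← Finset.sum_add_distrib]
      refine (mul_le_mul_of_nonneg_left (hβ v i) zero_le_two).trans ?_
      rw [Finset.mul_sum]
      refine Finset.sum_le_sum fun ω _ => ?_
      have h := hpt v i ω
      nlinarith [mul_le_mul_of_nonneg_right (min_le_left (W v ω) (W (flipCoord i v) ω))
          (sub_nonneg.2 h.1),
        mul_le_mul_of_nonneg_right (min_le_right (W v ω) (W (flipCoord i v) ω))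
          (by linarith [h.2] : 0 ≤ 1 + boolSign (v i) * x ω i)]
    rw [← hflip, Finset.sum_const, Finset.card_univ, nsmul_eq_mul] at hsum
    linarith
  set C := ∑ i, c i with hC
  have htotal : ∑ v : I → Bool, β * C ≤
      ∑ v, ∑ ω, W v ω * ∑ i, c i * (1 - boolSign (v i) * x ω i) := by
    have hswap : ∑ v, ∑ ω, W v ω * ∑ i, c i * (1 - boolSign (v i) * x ω i) =
        ∑ i, c i * ∑ v, ∑ ω, W v ω * (1 - boolSign (v i) * x ω i) := by
      simp only [Finset.mul_sum]
      rw [Finset.sum_comm (s := (univ : Finset I))]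
      refine Finset.sum_congr rfl fun v _ => ?_
      rw [Finset.sum_comm]
      exact Finset.sum_congr rfl fun i _ => Finset.sum_congr rfl fun ω _ => by ring
    rw [hswap, Finset.sum_const, Finset.card_univ, nsmul_eq_mul, hC, ← mul_assoc, Finset.mul_sum]
    refine Finset.sum_le_sum fun i _ => ?_
    rw [mul_comm]
    exact mul_le_mul_of_nonneg_left (hcoord i) (hc i)
  obtain ⟨v, -, hv⟩ := Finset.exists_le_of_sum_le Finset.univ_nonempty htotal
  refine ⟨v, ?_⟩
  set L : Ω → ℝ := fun ω => ∑ i, c i * (1 - boolSign (v i) * x ω i) with hL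
  have hL2 : ∀ ω, L ω ≤ 2 * C := by
    intro ω
    rw [hC, Finset.mul_sum]
    refine Finset.sum_le_sum fun i _ => ?_
    rw [mul_comm 2]
    exact mul_le_mul_of_nonneg_left (by linarith [(hpt v i ω).2]) (hc i)
  have hmarkov : ∑ ω, W v ω * L ω ≤
      ∑ ω, (W v ω * (η * C) + (if η * C ≤ L ω then W v ω else 0) * (2 * C)) := by
    refine Finset.sum_le_sum fun ω _ => ?_
    split_ifs with h
    · have := mul_le_mul_of_nonneg_left (hL2 ω) (hW v ω)
      have := mul_nonneg (hW v ω) (mul_nonneg hη hc0.le)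
      linarith
    · have := mul_le_mul_of_nonneg_left (not_le.1 h).le (hW v ω)
      linarith
  rw [Finset.sum_add_distrib, ← Finset.sum_mul, ← Finset.sum_mul, hW1, one_mul,
    ← Finset.sum_filter] at hmarkov
  have := hv.trans hmarkov
  refine le_of_mul_le_mul_right ?_ (mul_pos two_pos hc0)
  linarith

section HardInstance

/-- States of the hard instances: `K` gadgets with four states each (two decision states, a good
state and a bad state), and `L` isolated states. -/
abbrev GadgetState (K L : ℕ) : Type := (Fin K × Fin 4) ⊕ Fin L

/-- Transition matrix of a gadget with states `0, 1` (decision), `2` (good), `3` (bad): the chain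
moves with probability `h`, and `x` tilts the decision states in opposite directions. -/
def gadgetMatrix (h x : ℝ) : Matrix (Fin 4) (Fin 4) ℝ :=
  !![1 - h, 0, h * (1 / 2 + x), h * (1 / 2 - x);
    0, 1 - h, h * (1 / 2 - x), h * (1 / 2 + x);
    h / 2, h / 2, 1 - h, 0;
    h / 2, h / 2, 0, 1 - h]

/-- Disjoint union of `K` gadgets with tilts `x`, and of `L` absorbing states. -/
def gadgetKernel {K L : ℕ} (h : ℝ) (x : Fin K → ℝ) : GadgetState K L → GadgetState K L → ℝ
  | .inl (k, j), .inl (k', j') => if k = k' then gadgetMatrix h (x k) j j' else 0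
  | .inl _, .inr _ => 0
  | .inr _, .inl _ => 0
  | .inr l, .inr l' => if l = l' then 1 else 0

/-- Reward one in the good state of every gadget. -/
def gadgetReward {K L : ℕ} : GadgetState K L → ℝ
  | .inl (_, j) => if j = 2 then 1 else 0
  | .inr _ => 0

lemma gadgetMatrix_nonneg {h x : ℝ} (h0 : 0 ≤ h) (h1 : h ≤ 1) (hx : |x| ≤ 1 / 2) (i j : Fin 4) :
    0 ≤ gadgetMatrix h x i j := by
  have hx' := abs_le.1 hx
  have : 0 ≤ h * (1 / 2 + x) := mul_nonneg h0 (by linarith)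
  have : 0 ≤ h * (1 / 2 - x) := mul_nonneg h0 (by linarith)
  fin_cases i <;> fin_cases j <;> simp [gadgetMatrix] <;> first | assumption | linarith

lemma sum_gadgetMatrix (h x : ℝ) (i : Fin 4) : ∑ j, gadgetMatrix h x i j = 1 := by
  fin_cases i <;> simp [gadgetMatrix, Fin.sum_univ_four] <;> ring

lemma gadgetMatrix_eq_add_mul (h x : ℝ) (i j : Fin 4) :
    gadgetMatrix h x i j =
      gadgetMatrix h 0 i j + x * (gadgetMatrix h 1 i j - gadgetMatrix h 0 i j) := by
  fin_cases i <;> fin_cases j <;> simp [gadgetMatrix] <;> ring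

lemma sum_mul_gadgetMatrix_ite {A : Type} [Fintype A] [DecidableEq A] (p : A → ℝ)
    (hp : ∑ a, p a = 1) (a₁ : A) (h x : ℝ) (i j : Fin 4) :
    ∑ a, p a * gadgetMatrix h (if a = a₁ then x else 0) i j =
      gadgetMatrix h (p a₁ * x) i j := by
  rw [gadgetMatrix_eq_add_mul h (p a₁ * x)]
  calc
    _ = ∑ a, (p a * gadgetMatrix h 0 i j + if a = a₁ then
          p a * (x * (gadgetMatrix h 1 i j - gadgetMatrix h 0 i j)) else 0) := by
        refine Finset.sum_congr rfl fun a _ => ?_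
        split_ifs
        · rw [gadgetMatrix_eq_add_mul h x]
          ring
        · ring
    _ = _ := by
        rw [Finset.sum_add_distrib, ← Finset.sum_mul, hp, Finset.sum_ite_eq']
        simp [mul_assoc]

lemma sqrt_quarter_sub_sq_ge {x : ℝ} (hx : |x| ≤ 1 / 2) :
    1 / 2 - 2 * x ^ 2 ≤ √((1 / 2 + x) * (1 / 2 - x)) := by
  have hx2 : x ^ 2 ≤ 1 / 4 := by
    rw [← sq_abs]
    nlinarith [abs_nonneg x]
  refine Real.le_sqrt_of_sq_le ?_
  nlinarith [mul_nonneg (sq_nonneg x) (sub_nonneg.2 hx2)]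

lemma one_sub_le_sum_sqrt_gadgetMatrix {h x : ℝ} (h0 : 0 ≤ h) (h1 : h ≤ 1) (hx : |x| ≤ 1 / 2)
    (i : Fin 4) :
    1 - (if i = 0 ∨ i = 1 then 4 * h * x ^ 2 else 0) ≤
      ∑ j, √(gadgetMatrix h x i j * gadgetMatrix h (-x) i j) := by
  have hh : 0 ≤ 1 - h := by linarith
  have hh2 : 0 ≤ h / 2 := by linarith
  have hs := mul_le_mul_of_nonneg_left (sqrt_quarter_sub_sq_ge hx) h0
  have e1 : √(h * (1 / 2 + x) * (h * (1 / 2 - x))) = h * √((1 / 2 + x) * (1 / 2 - x)) := by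
    rw [mul_mul_mul_comm, Real.sqrt_mul (mul_self_nonneg h), Real.sqrt_mul_self h0]
  have e2 : √(h * (1 / 2 - x) * (h * (1 / 2 + x))) = h * √((1 / 2 + x) * (1 / 2 - x)) := by
    rw [mul_comm, e1]
  have e3 := Real.sqrt_mul_self hh
  have e4 := Real.sqrt_mul_self hh2
  simp only [one_div] at e1 e2 hs
  fin_cases i <;>
    simp [gadgetMatrix, Fin.sum_univ_four, e1, e2, e3, e4, ← sub_eq_add_neg] <;> linarith

variable {S A : Type} [Fintype S] [Fintype A] [DecidableEq A] {K L : ℕ}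

lemma sum_equiv_gadgetState (e : S ≃ GadgetState K L) (f : S → ℝ) :
    ∑ s, f s = ∑ k, ∑ j, f (e.symm (.inl (k, j))) + ∑ l, f (e.symm (.inr l)) := by
  rw [← e.symm.sum_comp, Fintype.sum_sum_type, Fintype.sum_prod_type]

/-- The hard instance with tilts `x t k` of action `a₁` at time `t` in gadget `k`: gadgets are
active before time `T`, and rewards are collected from time `T` on. -/
def hardMDP [Nonempty S] (e : S ≃ GadgetState K L) (a₁ : A) (T : ℕ) {h : ℝ} (h0 : 0 ≤ h)
    (h1 : h ≤ 1) (x : ℕ → Fin K → ℝ) (hx : ∀ t k, |x t k| ≤ 1 / 2) : MDP S A where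
  P t s a s' := gadgetKernel (if t < T then h else 0) (fun k => if a = a₁ then x t k else 0)
    (e s) (e s')
  P_nonneg t s a s' := by
    rcases e s with ⟨k, j⟩ | l <;> rcases e s' with ⟨k', j'⟩ | l' <;>
      simp only [gadgetKernel, le_refl]
    · split_ifs <;>
        first | exact le_rfl | (apply gadgetMatrix_nonneg <;> first | positivity | simp_all)
    · split_ifs <;> norm_num
  P_sum t s a := by
    rw [sum_equiv_gadgetState e]
    rcases e s with ⟨k, j⟩ | l
    · simp only [Equiv.apply_symm_apply, gadgetKernel, Finset.sum_const_zero, add_zero]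
      rw [Finset.sum_eq_single k (fun k' _ hk => by simp [hk.symm]) (by simp)]
      simp only [if_true, sum_gadgetMatrix]
    · simp [gadgetKernel]
  r t s _ := if T ≤ t then gadgetReward (e s) else 0
  r_nonneg t s _ := by
    rcases e s with ⟨k, j⟩ | l <;> simp only [gadgetReward] <;> split_ifs <;> norm_num
  r_le_one t s _ := by
    rcases e s with ⟨k, j⟩ | l <;> simp only [gadgetReward] <;> split_ifs <;> norm_num
  d₁ _ := 1 / Fintype.card S
  d₁_nonneg _ := by positivity
  d₁_sum := by simp

/-- State distribution of the MDP `M` under the policy `π`, in gadget coordinates. -/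
def gadgetDist (M : MDP S A) (e : S ≃ GadgetState K L) (π : ℕ → S → A → ℝ) (t : ℕ)
    (z : GadgetState K L) : ℝ :=
  stateDist M.P M.d₁ π t (e.symm z)

section Dynamics

variable [Nonempty S] (e : S ≃ GadgetState K L) (a₁ : A) (T : ℕ) {h : ℝ} (h0 : 0 ≤ h)
    (h1 : h ≤ 1) (x : ℕ → Fin K → ℝ) (hx : ∀ t k, |x t k| ≤ 1 / 2)

lemma hardMDP_stateDist_succ_inl {π : ℕ → S → A → ℝ} (hπ : IsPolicy π) (t : ℕ) (k : Fin K)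
    (j' : Fin 4) :
    gadgetDist (hardMDP e a₁ T h0 h1 x hx) e π (t + 1) (.inl (k, j')) = ∑ j,
      gadgetDist (hardMDP e a₁ T h0 h1 x hx) e π t (.inl (k, j)) *
      gadgetMatrix (if t < T then h else 0) (π t (e.symm (.inl (k, j))) a₁ * x t k) j j' := by
  simp only [gadgetDist, stateDist]
  rw [sum_equiv_gadgetState e, Finset.sum_eq_single k]
  · simp only [hardMDP, Equiv.apply_symm_apply, gadgetKernel, if_true, mul_zero,
      Finset.sum_const_zero, add_zero]
    exact Finset.sum_congr rfl fun j _ => by rw [sum_mul_gadgetMatrix_ite _ (hπ.2 _ _)]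
  · intro k' _ hk
    simp [hardMDP, gadgetKernel, hk]
  · simp

lemma hardMDP_stateDist_inr {π : ℕ → S → A → ℝ} (hπ : IsPolicy π) (t : ℕ) (l : Fin L) :
    gadgetDist (hardMDP e a₁ T h0 h1 x hx) e π t (.inr l) = 1 / Fintype.card S := by
  induction t with
  | zero => rfl
  | succ t ih =>
    simp only [gadgetDist, stateDist] at ih ⊢
    rw [sum_equiv_gadgetState e, Finset.sum_eq_single l]
    · simp [hardMDP, gadgetKernel, hπ.2] at ih ⊢
      simpa using ih
    · intro l' _ hl
      simp [hardMDP, gadgetKernel, hl]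
    · simp

lemma hardMDP_stateDist_decision {π : ℕ → S → A → ℝ} (hπ : IsPolicy π) (t : ℕ) (k : Fin K) :
    gadgetDist (hardMDP e a₁ T h0 h1 x hx) e π t (.inl (k, 0)) = 1 / Fintype.card S ∧
      gadgetDist (hardMDP e a₁ T h0 h1 x hx) e π t (.inl (k, 1)) = 1 / Fintype.card S ∧
      gadgetDist (hardMDP e a₁ T h0 h1 x hx) e π t (.inl (k, 2)) +
        gadgetDist (hardMDP e a₁ T h0 h1 x hx) e π t (.inl (k, 3)) = 2 / Fintype.card S := by
  induction t with
  | zero =>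
    refine ⟨rfl, rfl, ?_⟩
    simp only [gadgetDist, stateDist, hardMDP]
    ring
  | succ t ih =>
    obtain ⟨i0, i1, i2⟩ := ih
    have i3 := eq_sub_of_add_eq' i2
    simp only [hardMDP_stateDist_succ_inl e a₁ T h0 h1 x hx hπ, Fin.sum_univ_four, i0, i1, i3]
    generalize (if t < T then h else 0) = h'
    refine ⟨?_, ?_, ?_⟩ <;> simp [gadgetMatrix] <;> ring

lemma hardMDP_stateDist_good_succ {π : ℕ → S → A → ℝ} (hπ : IsPolicy π) (t : ℕ) (k : Fin K) :
    gadgetDist (hardMDP e a₁ T h0 h1 x hx) e π (t + 1) (.inl (k, 2)) =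
      (1 - if t < T then h else 0) * gadgetDist (hardMDP e a₁ T h0 h1 x hx) e π t (.inl (k, 2)) +
        (if t < T then h else 0) /
        Fintype.card S * (1 + x t k *
          (π t (e.symm (.inl (k, 0))) a₁ - π t (e.symm (.inl (k, 1))) a₁)) := by
  obtain ⟨i0, i1, -⟩ := hardMDP_stateDist_decision e a₁ T h0 h1 x hx hπ t k
  simp only [hardMDP_stateDist_succ_inl e a₁ T h0 h1 x hx hπ, Fin.sum_univ_four, i0, i1]
  generalize (if t < T then h else 0) = h'
  simp [gadgetMatrix]
  ring

lemma hardMDP_stateDist_good {π : ℕ → S → A → ℝ} (hπ : IsPolicy π) (t : ℕ) (ht : t ≤ T)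
    (k : Fin K) :
    gadgetDist (hardMDP e a₁ T h0 h1 x hx) e π t (.inl (k, 2)) =
      1 / Fintype.card S + h / Fintype.card S *
      ∑ u ∈ Finset.range t, (1 - h) ^ (t - 1 - u) * (x u k *
        (π u (e.symm (.inl (k, 0))) a₁ - π u (e.symm (.inl (k, 1))) a₁)) := by
  induction t with
  | zero => simp [gadgetDist, stateDist, hardMDP]
  | succ t ih =>
    have ih := ih (by omega)
    have hg := hardMDP_stateDist_good_succ e a₁ T h0 h1 x hx hπ t k
    simp only [if_pos (Nat.lt_of_succ_le ht)] at hg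
    rw [hg, ih, Finset.sum_range_succ]
    have : ∀ u ∈ Finset.range t, (1 - h) ^ (t + 1 - 1 - u) * (x u k *
        (π u (e.symm (.inl (k, 0))) a₁ - π u (e.symm (.inl (k, 1))) a₁)) =
        (1 - h) * ((1 - h) ^ (t - 1 - u) * (x u k *
        (π u (e.symm (.inl (k, 0))) a₁ - π u (e.symm (.inl (k, 1))) a₁))) := by
      intro u hu
      have := Finset.mem_range.1 hu
      rw [← mul_assoc (1 - h), ← pow_succ']
      congr 2
      omega
    rw [Finset.sum_congr rfl this, ← Finset.mul_sum]
    simp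
    ring

lemma hardMDP_stateDist_good_of_le {π : ℕ → S → A → ℝ} (hπ : IsPolicy π) (t : ℕ) (ht : T ≤ t)
    (k : Fin K) :
    gadgetDist (hardMDP e a₁ T h0 h1 x hx) e π t (.inl (k, 2)) =
      gadgetDist (hardMDP e a₁ T h0 h1 x hx) e π T (.inl (k, 2)) := by
  induction t, ht using Nat.le_induction with
  | base => rfl
  | succ t ht ih =>
    have hg := hardMDP_stateDist_good_succ e a₁ T h0 h1 x hx hπ t k
    simp only [if_neg (not_lt.2 ht)] at hg
    rw [hg, ih]
    simp

/-- A policy that treats all states alike keeps the state distribution uniform. -/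
lemma hardMDP_stateDist_uniform {μ : ℕ → S → A → ℝ} (hμ : IsPolicy μ)
    (hμs : ∀ t s s', μ t s a₁ = μ t s' a₁) (t : ℕ) (s : S) :
    stateDist (hardMDP e a₁ T h0 h1 x hx).P (hardMDP e a₁ T h0 h1 x hx).d₁ μ t s =
      1 / Fintype.card S := by
  obtain ⟨z, rfl⟩ := e.symm.surjective s
  have hgood : ∀ k,
      gadgetDist (hardMDP e a₁ T h0 h1 x hx) e μ t (.inl (k, 2)) = 1 / Fintype.card S := by
    intro k
    have h' : ∀ t ≤ T,
        gadgetDist (hardMDP e a₁ T h0 h1 x hx) e μ t (.inl (k, 2)) = 1 / Fintype.card S := by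
      intro t ht
      have := hardMDP_stateDist_good e a₁ T h0 h1 x hx hμ t ht k
      simpa [hμs _ (e.symm (.inl (k, 0))) (e.symm (.inl (k, 1)))] using this
    rcases le_total t T with ht | ht
    · exact h' t ht
    · exact (hardMDP_stateDist_good_of_le e a₁ T h0 h1 x hx hμ t ht k).trans (h' T le_rfl)
  rcases z with ⟨k, j⟩ | l
  · obtain ⟨i0, i1, i2⟩ := hardMDP_stateDist_decision e a₁ T h0 h1 x hx hμ t k
    have i3 := hgood k
    fin_cases j
    · exact i0
    · exact i1
    · exact i3
    · have : ∀ a b c : ℝ, a + b = 2 / c → a = 1 / c → b = 1 / c := by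
        intro a b c h h'
        rw [h'] at h
        linear_combination h
      exact this _ _ _ i2 i3
  · exact hardMDP_stateDist_inr e a₁ T h0 h1 x hx hμ t l

lemma hardMDP_polValue {π : ℕ → S → A → ℝ} (hπ : IsPolicy π) {H : ℕ} (hTH : T ≤ H) :
    polValue (hardMDP e a₁ T h0 h1 x hx).P (hardMDP e a₁ T h0 h1 x hx).r
      (hardMDP e a₁ T h0 h1 x hx).d₁ π H =
      (H - T : ℝ) * ∑ k, (1 / Fintype.card S + h / Fintype.card S *
        ∑ u ∈ Finset.range T, (1 - h) ^ (T - 1 - u) * (x u k *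
          (π u (e.symm (.inl (k, 0))) a₁ - π u (e.symm (.inl (k, 1))) a₁))) := by
  have hslice : ∀ t, ∑ s, stateDist (hardMDP e a₁ T h0 h1 x hx).P
      (hardMDP e a₁ T h0 h1 x hx).d₁ π t s * ∑ a, π t s a * (hardMDP e a₁ T h0 h1 x hx).r t s a =
      if T ≤ t then ∑ k, gadgetDist (hardMDP e a₁ T h0 h1 x hx) e π T (.inl (k, 2)) else 0 := by
    intro t
    split_ifs with ht
    · have hr : ∀ s, ∑ a, π t s a * (hardMDP e a₁ T h0 h1 x hx).r t s a = gadgetReward (e s) := by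
        intro s
        simp only [hardMDP, if_pos ht, ← Finset.sum_mul, hπ.2, one_mul]
      simp only [hr]
      rw [sum_equiv_gadgetState e]
      simp only [Equiv.apply_symm_apply, gadgetReward, mul_ite, mul_one, mul_zero,
        Finset.sum_ite_eq', Finset.mem_univ, if_true, Finset.sum_const_zero, add_zero]
      exact Finset.sum_congr rfl fun k _ =>
        hardMDP_stateDist_good_of_le e a₁ T h0 h1 x hx hπ t ht k
    · simp [hardMDP, ht]
  rw [polValue_eq]
  simp only [hslice]
  rw [Finset.range_eq_Ico, ← Finset.sum_Ico_consecutive _ (Nat.zero_le T) hTH,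
    Finset.sum_eq_zero (s := Finset.Ico 0 T) fun t ht => if_neg (by simpa using ht), zero_add,
    Finset.sum_congr rfl fun t ht => if_pos (Finset.mem_Ico.1 ht).1, Finset.sum_const,
    Nat.card_Ico, nsmul_eq_mul, Nat.cast_sub hTH]
  congr 1
  exact Finset.sum_congr rfl fun k _ => hardMDP_stateDist_good e a₁ T h0 h1 x hx hπ T le_rfl k

/-- Bhattacharyya coefficient of two hard instances whose tilts differ by a sign at `(t₀, k₀)`. -/
lemma hardMDP_sum_sqrt_pathWeight [Inhabited S] [Inhabited A] (x' : ℕ → Fin K → ℝ)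
    (hx' : ∀ t k, |x' t k| ≤ 1 / 2) {t₀ : ℕ} {k₀ : Fin K} (hflip : x' t₀ k₀ = -x t₀ k₀)
    (hne : ∀ t k, (t, k) ≠ (t₀, k₀) → x' t k = x t k) (ht₀ : t₀ < T)
    {μ : ℕ → S → A → ℝ} (hμ : IsPolicy μ) (hμs : ∀ t s s', μ t s a₁ = μ t s' a₁) {α : ℝ}
    (hα : ∀ t s, μ t s a₁ = α) {H : ℕ} (hH : T < H) :
    1 - 8 * α * h * x t₀ k₀ ^ 2 / Fintype.card S ≤ ∑ p : Fin H → S × A,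
      √(pathWeight (hardMDP e a₁ T h0 h1 x hx) μ p *
        pathWeight (hardMDP e a₁ T h0 h1 x' hx') μ p) := by
  classical
  rw [sum_sqrt_mul_pathWeight (hardMDP e a₁ T h0 h1 x hx) (hardMDP e a₁ T h0 h1 x' hx') rfl
    (t₀ := t₀) ?_ hμ (by omega)]
  swap
  · intro t ht
    have : x' t = x t := funext fun k => hne t k (by simp [ht])
    simp only [hardMDP, this]
  set M := hardMDP e a₁ T h0 h1 x hx with hM
  set M' := hardMDP e a₁ T h0 h1 x' hx' with hM'
  let loss : GadgetState K L → ℝ := fun z => ∑ j ∈ ({0, 1} : Finset (Fin 4)),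
    if z = .inl (k₀, j) then 4 * h * x t₀ k₀ ^ 2 else 0
  have hrow : ∀ s a, 1 - (if a = a₁ then loss (e s) else 0) ≤
      ∑ s', √(M.P t₀ s a s' * M'.P t₀ s a s') := by
    intro s a
    by_cases hsame : a = a₁ ∧ ∃ j, e s = .inl (k₀, j)
    · obtain ⟨rfl, j, hj⟩ := hsame
      rw [sum_equiv_gadgetState e]
      simp only [hM, hM', hardMDP, hj, Equiv.apply_symm_apply, gadgetKernel, if_true, ht₀,
        mul_zero, Real.sqrt_zero, Finset.sum_const_zero, add_zero]
      rw [Finset.sum_eq_single k₀ (fun k _ hk => by simp [hk.symm]) (by simp)]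
      simp only [if_true, hflip]
      refine le_trans (le_of_eq ?_) (one_sub_le_sum_sqrt_gadgetMatrix h0 h1 (hx t₀ k₀) j)
      fin_cases j <;> simp [loss]
    · have hP : ∀ s', M'.P t₀ s a s' = M.P t₀ s a s' := by
        intro s'
        simp only [hM, hM', hardMDP]
        rcases hs : e s with ⟨k, j⟩ | l <;> rcases e s' with ⟨k', j'⟩ | l' <;>
          simp only [gadgetKernel]
        by_cases ha : a = a₁
        · have hk : k ≠ k₀ := fun hk => hsame ⟨ha, j, by rw [hs, hk]⟩
          rw [hne t₀ k (by simp [hk])]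
        · simp [ha]
      simp only [hP, Real.sqrt_mul_self (M.P_nonneg _ _ _ _), M.P_sum]
      refine sub_le_self _ ?_
      split_ifs
      · refine Finset.sum_nonneg fun j _ => ?_
        split_ifs <;> positivity
      · exact le_rfl
  have hloss : ∑ s, loss (e s) = 8 * h * x t₀ k₀ ^ 2 := by
    rw [e.sum_comp loss, Finset.sum_comm]
    simp
    ring
  calc
    _ = ∑ s, 1 / (Fintype.card S : ℝ) * (1 - α * loss (e s)) := by
        rw [← Finset.mul_sum, Finset.sum_sub_distrib, ← Finset.mul_sum, hloss]
        have : (Fintype.card S : ℝ) ≠ 0 := by exact_mod_cast Fintype.card_ne_zero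
        simp
        field_simp
    _ = ∑ s, 1 / (Fintype.card S : ℝ) *
          ∑ a, μ t₀ s a * (1 - if a = a₁ then loss (e s) else 0) := by
        simp [mul_sub, Finset.sum_sub_distrib, hμ.2, hα]
    _ ≤ _ := by
        refine Finset.sum_le_sum fun s _ => ?_
        rw [hardMDP_stateDist_uniform e a₁ T h0 h1 x hx hμ hμs]
        gcongr with a
        · exact hμ.1 t₀ s a
        · exact hrow s a

end Dynamics
end HardInstance

section Regret

lemma isPolicy_detToPolicy {S A : Type} [Fintype A] [DecidableEq A] (g : ℕ → S → A) :
    IsPolicy (detToPolicy g) := by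
  constructor
  · intro t s a
    simp only [detToPolicy]
    split_ifs <;> norm_num
  · intro t s
    simp [detToPolicy]

variable {S A : Type} [Fintype S] [Fintype A] [DecidableEq A] {K L : ℕ}
  [Nonempty S] (e : S ≃ GadgetState K L) {a₀ a₁ : A} (T : ℕ) {h : ℝ} (h0 : 0 ≤ h)
  (h1 : h ≤ 1)

/-- Suboptimality of a policy in the hard instance. -/
lemma hardMDP_regret (ha : a₀ ≠ a₁) (x : ℕ → Fin K → ℝ) (hx : ∀ t k, |x t k| ≤ 1 / 2)
    {π : ℕ → S → A → ℝ} (hπ : IsPolicy π) {H : ℕ} (hTH : T ≤ H) :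
    (H - T : ℝ) * (h / Fintype.card S) *
      ∑ k, ∑ u ∈ Finset.range T, (1 - h) ^ (T - 1 - u) * (|x u k| - x u k *
          (π u (e.symm (.inl (k, 0))) a₁ - π u (e.symm (.inl (k, 1))) a₁)) ≤
      vStar (hardMDP e a₁ T h0 h1 x hx) H -
        polValue (hardMDP e a₁ T h0 h1 x hx).P (hardMDP e a₁ T h0 h1 x hx).r
          (hardMDP e a₁ T h0 h1 x hx).d₁ π H := by
  classical
  let g : ℕ → S → A := fun t s =>
    Sum.elim (fun kj : Fin K × Fin 4 => if (0 ≤ x t kj.1 ↔ kj.2 = 0) then a₁ else a₀)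
      (fun _ => a₁) (e s)
  have hg : ∀ u k, x u k * (detToPolicy g u (e.symm (.inl (k, 0))) a₁ -
      detToPolicy g u (e.symm (.inl (k, 1))) a₁) = |x u k| := by
    intro u k
    by_cases hxk : 0 ≤ x u k
    · simp [detToPolicy, g, hxk, ha.symm, abs_of_nonneg hxk]
    · simp [detToPolicy, g, hxk, ha.symm, abs_of_neg (not_le.1 hxk)]
  have hopt := polValue_le_vStar (hardMDP e a₁ T h0 h1 x hx) (isPolicy_detToPolicy g) H
  rw [hardMDP_polValue e a₁ T h0 h1 x hx (isPolicy_detToPolicy g) hTH] at hopt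
  rw [hardMDP_polValue e a₁ T h0 h1 x hx hπ hTH]
  simp only [hg] at hopt
  refine le_trans (le_of_eq ?_) (sub_le_sub_right hopt _)
  simp only [mul_sub, Finset.sum_sub_distrib, Finset.sum_add_distrib, mul_add, ← Finset.mul_sum]
  ring

/-- Tilts of magnitude `τ` whose signs are given by `v`. -/
def signTilt (τ : ℝ) (v : Fin T × Fin K → Bool) (t : ℕ) (k : Fin K) : ℝ :=
  if ht : t < T then τ * boolSign (v (⟨t, ht⟩, k)) else 0

lemma abs_signTilt_le {τ : ℝ} (hτ0 : 0 ≤ τ) (hτ1 : τ ≤ 1 / 2) (v : Fin T × Fin K → Bool) (t : ℕ)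
    (k : Fin K) : |signTilt T τ v t k| ≤ 1 / 2 := by
  unfold signTilt
  split_ifs
  · rwa [abs_mul, abs_boolSign, mul_one, abs_of_nonneg hτ0]
  · simp

lemma signTilt_coe (τ : ℝ) (v : Fin T × Fin K → Bool) (t : Fin T) (k : Fin K) :
    signTilt T τ v t k = τ * boolSign (v (t, k)) := by
  simp [signTilt]

lemma signTilt_flipCoord_of_ne (τ : ℝ) (v : Fin T × Fin K → Bool) (i : Fin T × Fin K) (t : ℕ)
    (k : Fin K) (hne : (t, k) ≠ ((i.1 : ℕ), i.2)) :
    signTilt T τ (flipCoord i v) t k = signTilt T τ v t k := by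
  unfold signTilt
  split_ifs with ht
  · have : ((⟨t, ht⟩, k) : Fin T × Fin K) ≠ i := by
      rintro rfl
      exact hne rfl
    simp [flipCoord, Function.update_of_ne this]
  · rfl

variable [Inhabited S] [Inhabited A] [MeasurableSpace S] [MeasurableSpace A]
  [MeasurableSingletonClass S] [MeasurableSingletonClass A]

/-- Every algorithm fails with constant probability on some hard instance, as soon as the sample
size is too small to detect a single tilt. -/
lemma exists_hardMDP_regret (ha : a₀ ≠ a₁) {H n : ℕ} (hT : 0 < T) (hTH : T < H) (hK : 0 < K)
    {τ : ℝ} (hτ0 : 0 ≤ τ) (hτ1 : τ ≤ 1 / 2) (hh : h < 1) {μ : ℕ → S → A → ℝ}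
    (hμ : IsPolicy μ) {α : ℝ} (hα : ∀ t s, μ t s a₁ = α)
    (hn : n * (8 * α * h * τ ^ 2 / Fintype.card S) ≤ 1 / 20)
    (out : Dataset S A H n → (ℕ → S → A → ℝ)) (hout : ∀ D, IsPolicy (out D)) :
    ∃ (x : ℕ → Fin K → ℝ) (hx : ∀ t k, |x t k| ≤ 1 / 2),
      ENNReal.ofReal (1 / 40) ≤ datasetLaw (hardMDP e a₁ T h0 h1 x hx) μ
        (fun t s a => Measure.dirac ((hardMDP e a₁ T h0 h1 x hx).r t s a)) H n
        {D | (H - T : ℝ) * (h / Fintype.card S) * τ *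
            (2 / 5 * ∑ i : Fin T × Fin K, (1 - h) ^ (T - 1 - (i.1 : ℕ))) ≤
          vStar (hardMDP e a₁ T h0 h1 x hx) H -
            polValue (hardMDP e a₁ T h0 h1 x hx).P (hardMDP e a₁ T h0 h1 x hx).r
              (hardMDP e a₁ T h0 h1 x hx).d₁ (out D) H} := by
  classical
  have hμs : ∀ t s s', μ t s a₁ = μ t s' a₁ := fun t s s' => by rw [hα, hα]
  let M : (Fin T × Fin K → Bool) → MDP S A := fun v =>
    hardMDP e a₁ T h0 h1 (signTilt T τ v) (abs_signTilt_le T hτ0 hτ1 v)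
  let r : ℕ → S → A → ℝ := fun t s _ => if T ≤ t then gadgetReward (e s) else 0
  let W : (Fin T × Fin K → Bool) → (Fin n → Fin H → S × A) → ℝ := fun v p =>
    ∏ i, pathWeight (M v) μ (p i)
  let y : (Fin n → Fin H → S × A) → Fin T × Fin K → ℝ := fun p i =>
    out (meanRewardDataset r p) i.1 (e.symm (.inl (i.2, 0))) a₁ -
      out (meanRewardDataset r p) i.1 (e.symm (.inl (i.2, 1))) a₁
  have hW : ∀ v p, 0 ≤ W v p := fun v p =>
    Finset.prod_nonneg fun i _ => pathWeight_nonneg (M v) hμ (p i)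
  have hW1 : ∀ v, ∑ p, W v p = 1 := by
    intro v
    simp only [W]
    rw [← Fintype.sum_pow, sum_pathWeight (M v) hμ (by omega), one_pow]
  have hout1 : ∀ D t s, out D t s a₁ ≤ 1 := by
    intro D t s
    rw [← (hout D).2 t s]
    exact Finset.single_le_sum (fun a _ => (hout D).1 t s a) (Finset.mem_univ a₁)
  have hy : ∀ p i, |y p i| ≤ 1 := fun p i => abs_sub_le_of_nonneg_of_le
    ((hout _).1 _ _ _) (hout1 _ _ _) ((hout _).1 _ _ _) (hout1 _ _ _)
  have hc : ∀ i : Fin T × Fin K, 0 < (1 - h) ^ (T - 1 - (i.1 : ℕ)) := fun i =>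
    pow_pos (by linarith) _
  have hc0 : 0 < ∑ i : Fin T × Fin K, (1 - h) ^ (T - 1 - (i.1 : ℕ)) :=
    Finset.sum_pos (fun i _ => hc i) ⟨(⟨0, hT⟩, ⟨0, hK⟩), Finset.mem_univ _⟩
  have hδ : 0 ≤ 8 * α * h * τ ^ 2 / Fintype.card S := by
    have hα0 : 0 ≤ α := hα 0 default ▸ hμ.1 0 default a₁
    positivity
  have hβ : ∀ v i, (9 / 20 : ℝ) ≤ ∑ p, min (W v p) (W (flipCoord i v) p) := by
    intro v i
    have hBC := hardMDP_sum_sqrt_pathWeight e a₁ T h0 h1 (signTilt T τ v)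
      (abs_signTilt_le T hτ0 hτ1 v) (signTilt T τ (flipCoord i v))
      (abs_signTilt_le T hτ0 hτ1 (flipCoord i v)) (t₀ := i.1) (k₀ := i.2)
      (by rw [signTilt_coe, signTilt_coe, flipCoord_self, boolSign_not, mul_neg])
      (signTilt_flipCoord_of_ne T τ v i) i.1.2 hμ hμs hα hTH
    rw [signTilt_coe, mul_pow, sq (boolSign _), boolSign_mul_self, mul_one] at hBC
    have hpow : (19 / 20 : ℝ) ≤ ∑ p, √(W v p * W (flipCoord i v) p) := by
      rw [sum_prod_sqrt n _ _ (pathWeight_nonneg (M v) hμ)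
        (pathWeight_nonneg (M (flipCoord i v)) hμ)]
      rcases Nat.eq_zero_or_pos n with rfl | hn0
      · norm_num
      have hle : 8 * α * h * τ ^ 2 / Fintype.card S ≤ 1 / 20 :=
        (le_mul_of_one_le_left hδ (by exact_mod_cast hn0)).trans hn
      refine le_trans ?_ (pow_le_pow_left₀ (by linarith) hBC n)
      have := one_add_mul_le_pow (a := -(8 * α * h * τ ^ 2 / Fintype.card S)) (by linarith) n
      rw [← sub_eq_add_neg] at this
      linarith
    have := sq_sum_sqrt_le_two_mul_sum_min (W v) (W (flipCoord i v)) (hW _) (hW _) (hW1 _) (hW1 _)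
    nlinarith
  obtain ⟨v, hv⟩ := assouad W hW hW1 y hy (fun i => (1 - h) ^ (T - 1 - (i.1 : ℕ)))
    (fun i => (hc i).le) hc0 (η := 2 / 5) (by norm_num) hβ
  refine ⟨signTilt T τ v, abs_signTilt_le T hτ0 hτ1 v, le_trans (ENNReal.ofReal_le_ofReal ?_)
    (sum_prod_pathWeight_le_datasetLaw (M v) H n (pathWeight_nonneg (M v) hμ) _
      (univ.filter fun p => 2 / 5 * ∑ i : Fin T × Fin K, (1 - h) ^ (T - 1 - (i.1 : ℕ)) ≤
        ∑ i : Fin T × Fin K, (1 - h) ^ (T - 1 - (i.1 : ℕ)) * (1 - boolSign (v i) * y p i)) ?_)⟩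
  · exact le_trans (by norm_num) hv
  · intro p hp
    have hp := (Finset.mem_filter.1 hp).2
    refine le_trans ?_ (hardMDP_regret e T h0 h1 ha (signTilt T τ v)
      (abs_signTilt_le T hτ0 hτ1 v) (hout _) hTH.le)
    rw [mul_assoc _ τ]
    refine mul_le_mul_of_nonneg_left ((mul_le_mul_of_nonneg_left hp hτ0).trans (le_of_eq ?_)) ?_
    · rw [Fintype.sum_prod_type_right, Finset.mul_sum]
      refine Finset.sum_congr rfl fun k _ => ?_
      rw [Finset.sum_range, Finset.mul_sum]
      refine Finset.sum_congr rfl fun u _ => ?_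
      rw [signTilt_coe, abs_mul, abs_boolSign, abs_of_nonneg hτ0]
      change _ = (1 - h) ^ (T - 1 - (u : ℕ)) * (τ * 1 - τ * boolSign (v (u, k)) * y p (u, k))
      ring
    · have : (T : ℝ) ≤ H := by exact_mod_cast hTH.le
      exact mul_nonneg (by linarith) (by positivity)

end Regret

/-- The policy playing `a₁` with probability `α` and every other action equally often. -/
def tiltedPolicy (S : Type) {A : Type} [Fintype A] [DecidableEq A] (a₁ : A) (α : ℝ) :
    ℕ → S → A → ℝ :=
  fun _ _ a => if a = a₁ then α else (1 - α) / (Fintype.card A - 1)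

lemma isPolicy_tiltedPolicy (S : Type) {A : Type} [Fintype A] [DecidableEq A] (a₁ : A) {α : ℝ}
    (hA : 2 ≤ Fintype.card A) (hα0 : 0 ≤ α) (hα1 : α ≤ 1) :
    IsPolicy (tiltedPolicy S a₁ α) := by
  have hA' : (2 : ℝ) ≤ Fintype.card A := by exact_mod_cast hA
  constructor
  · intro t s a
    unfold tiltedPolicy
    split_ifs
    · exact hα0
    · exact div_nonneg (by linarith) (by linarith)
  · intro t s
    have hne : (Fintype.card A : ℝ) - 1 ≠ 0 := by linarith
    have hcard : ((univ.erase a₁).card : ℝ) = Fintype.card A - 1 := by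
      rw [Finset.card_erase_of_mem (mem_univ _), Finset.card_univ, Nat.cast_sub (by omega),
        Nat.cast_one]
    simp only [tiltedPolicy]
    rw [← Finset.add_sum_erase _ _ (mem_univ a₁), Finset.sum_congr rfl (g := fun _ =>
      (1 - α) / ((Fintype.card A : ℝ) - 1)) fun a ha => if_neg (Finset.ne_of_mem_erase ha)]
    simp only [if_pos, Finset.sum_const, nsmul_eq_mul, hcard]
    field_simp
    ring

lemma le_tiltedPolicy {S A : Type} [Fintype A] [DecidableEq A] {a₁ : A} {α : ℝ}
    (hA : 2 ≤ Fintype.card A) (hα : α ≤ 1 / Fintype.card A) (t : ℕ) (s : S) (a : A) :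
    α ≤ tiltedPolicy S a₁ α t s a := by
  have hA' : (2 : ℝ) ≤ Fintype.card A := by exact_mod_cast hA
  unfold tiltedPolicy
  split_ifs
  · exact le_rfl
  · rw [le_div_iff₀ (by linarith)]
    rw [le_div_iff₀ (by linarith)] at hα
    linarith

/-- The suboptimality of the hard instance dominates the target accuracy. -/
lemma horizon_gap_bound {H S : ℕ} (hH : 2 ≤ H) (hS : 16 ≤ S) {ε : ℝ} (hε : 0 ≤ ε) :
    ε ≤ ((H : ℝ) - (H / 2 : ℕ)) * (1 / (H : ℝ) / S) * (120 * ε / H) *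
      (2 / 5 * ∑ i : Fin (H / 2) × Fin (S / 4), (1 - 1 / (H : ℝ)) ^ (H / 2 - 1 - (i.1 : ℕ))) := by
  have hH' : (2 : ℝ) ≤ H := by exact_mod_cast hH
  have hS' : (16 : ℝ) ≤ S := by exact_mod_cast hS
  have hT2 : ((H / 2 : ℕ) : ℝ) * 2 ≤ H := by exact_mod_cast Nat.div_mul_le_self H 2
  have hT3 : (H : ℝ) ≤ 3 * (H / 2 : ℕ) := by
    exact_mod_cast (by omega : H ≤ 3 * (H / 2))
  have hK : (S : ℝ) ≤ 5 * (S / 4 : ℕ) := by exact_mod_cast (by omega : S ≤ 5 * (S / 4))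
  generalize hT : H / 2 = T at *
  generalize S / 4 = K at *
  have hterm : ∀ u : ℕ, u ≤ T → (1 / 2 : ℝ) ≤ (1 - 1 / (H : ℝ)) ^ u := by
    intro u hu
    have hu' : (u : ℝ) ≤ T := by exact_mod_cast hu
    have hinv : 1 / (H : ℝ) ≤ 1 := by
      rw [div_le_one (by linarith)]
      linarith
    have hb := one_add_mul_le_pow (a := -(1 / (H : ℝ))) (by linarith) u
    rw [← sub_eq_add_neg] at hb
    refine le_trans ?_ hb
    have : (u : ℝ) * (1 / H) ≤ 1 / 2 := by
      rw [mul_one_div, div_le_iff₀ (by linarith)]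
      linarith
    linarith
  have hsum : (T : ℝ) * K / 2 ≤
      ∑ i : Fin T × Fin K, (1 - 1 / (H : ℝ)) ^ (T - 1 - (i.1 : ℕ)) := by
    calc (T : ℝ) * K / 2 = ∑ _i : Fin T × Fin K, (1 / 2 : ℝ) := by simp; ring
      _ ≤ _ := Finset.sum_le_sum fun i _ => hterm _ (by omega)
  have hTH : (2 / 9 : ℝ) * H ^ 2 ≤ T * (H - T) := by nlinarith
  calc ε ≤ ε * (240 / 225) := by linarith
    _ = 24 * ε * ((2 / 9 * H ^ 2) * (S / 5)) / (H ^ 2 * S) := by field_simp; ring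
    _ ≤ 24 * ε * ((T * (H - T)) * K) / (H ^ 2 * S) := by
        gcongr
        · nlinarith
        · linarith
    _ = ((H : ℝ) - T) * (1 / (H : ℝ) / S) * (120 * ε / H) * (2 / 5 * (T * K / 2)) := by
        field_simp; ring
    _ ≤ _ := by
        have : 0 ≤ (H : ℝ) - T := by linarith
        gcongr

end OPE

namespace OPE

/-- Theorem G.2, minimax lower bound for offline learning over `M_{d_m}`:
for `0 < d_m ≤ 1/(SA)`, `H ≥ 2`, `A ≥ 2`, `0 < ε < 1/(48√8)`, `S ≥ c₁`, any offline learning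
algorithm using `n ≤ c H³/(d_m ε²)` episodes fails to be `ε`-optimal with probability at least
`p` on some instance `(μ, M)` with `min_{t,s,a} d_t^μ(s,a) ≥ d_m`. -/
theorem offline_learning_minimax_lower_bound :
    ∃ c₁ c p : ℝ, 0 < c₁ ∧ 0 < c ∧ 0 < p ∧
      ∀ (S A : Type) [Fintype S] [Fintype A] [DecidableEq S] [DecidableEq A]
        [Inhabited S] [Inhabited A]
        [MeasurableSpace S] [MeasurableSingletonClass S]
        [MeasurableSpace A] [MeasurableSingletonClass A]
        (H n : ℕ) (dm ε : ℝ),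
        2 ≤ H → 2 ≤ Fintype.card A → c₁ ≤ (Fintype.card S : ℝ) →
        0 < dm → dm ≤ 1 / ((Fintype.card S : ℝ) * (Fintype.card A : ℝ)) →
        0 < ε → ε < 1 / (48 * Real.sqrt 8) →
        (n : ℝ) ≤ c * (H : ℝ) ^ 3 / (dm * ε ^ 2) →
        ∀ out : Dataset S A H n → (ℕ → S → A → ℝ),
          (∀ D, IsPolicy (out D)) → Measurable out →
          ∃ (M : MDP S A) (μ : ℕ → S → A → ℝ) (R : ℕ → S → A → Measure ℝ),
            IsPolicy μ ∧ ValidReward M R ∧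
            (∀ t < H, ∀ q : S × A, dm ≤ margDist M.P M.d₁ μ t q) ∧
            ENNReal.ofReal p ≤
              datasetLaw M μ R H n
                {D | ε ≤ vStar M H - polValue M.P M.r M.d₁ (out D) H} := by
  refine ⟨16, 1 / 2500000, 1 / 40, by norm_num, by norm_num, by norm_num, ?_⟩
  intro S A _ _ _ _ _ _ _ _ _ _ H n dm ε hH hA hS hdm hdm1 hε hε1 hn out hout _
  have hH' : (2 : ℝ) ≤ H := by exact_mod_cast hH
  have hA' : (2 : ℝ) ≤ Fintype.card A := by exact_mod_cast hA
  have hS' : 16 ≤ Fintype.card S := by exact_mod_cast hS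
  let e : S ≃ GadgetState (Fintype.card S / 4) (Fintype.card S - 4 * (Fintype.card S / 4)) :=
    Fintype.equivOfCardEq (by
      simp only [Fintype.card_sum, Fintype.card_prod, Fintype.card_fin]
      omega)
  obtain ⟨a₀, ha⟩ := Fintype.exists_ne_of_one_lt_card (by omega : 1 < Fintype.card A) default
  have hα : dm * Fintype.card S ≤ 1 / Fintype.card A := by
    rw [le_div_iff₀ (by positivity)] at hdm1 ⊢
    linarith
  have hμ : IsPolicy (tiltedPolicy S (default : A) (dm * Fintype.card S)) :=
    isPolicy_tiltedPolicy S _ hA (by positivity) (hα.trans (by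
      rw [div_le_one (by linarith)]
      linarith))
  have hh : 1 / (H : ℝ) < 1 := by
    rw [div_lt_one (by linarith)]
    linarith
  have hτ : 120 * ε / H ≤ 1 / 2 := by
    have h8 : (5 / 2 : ℝ) ≤ √8 := Real.le_sqrt_of_sq_le (by norm_num)
    have hε2 : ε ≤ 1 / 120 := hε1.le.trans (one_div_le_one_div_of_le (by norm_num) (by linarith))
    rw [div_le_iff₀ (by linarith)]
    linarith
  have hδ : n * (8 * (dm * Fintype.card S) * (1 / (H : ℝ)) * (120 * ε / H) ^ 2 /
      Fintype.card S) ≤ 1 / 20 := by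
    rw [le_div_iff₀ (by positivity)] at hn
    have heq : n * (8 * (dm * Fintype.card S) * (1 / (H : ℝ)) * (120 * ε / H) ^ 2 /
        Fintype.card S) = 115200 * (n * (dm * ε ^ 2)) / (H : ℝ) ^ 3 := by
      field_simp
      ring
    rw [heq, div_le_iff₀ (by positivity)]
    nlinarith [pow_pos (by linarith : (0 : ℝ) < H) 3]
  obtain ⟨x, hx, hlaw⟩ := exists_hardMDP_regret e (H / 2) (by positivity) hh.le ha
    (by omega) (by omega) (by omega) (by positivity) hτ hh hμ
    (fun t s => if_pos rfl) hδ out hout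
  refine ⟨_, _, _, hμ, validReward_dirac _, fun t _ q => ?_, hlaw.trans (measure_mono
    fun D hD => (horizon_gap_bound hH hS' hε.le).trans hD)⟩
  rw [margDist_eq_mul_stateDist, hardMDP_stateDist_uniform e default (H / 2) _ _ x hx hμ
    (fun t s s' => by simp [tiltedPolicy]) t q.1]
  have := le_tiltedPolicy (a₁ := default) hA hα t q.1 q.2
  rw [mul_one_div, le_div_iff₀ (by positivity)]
  exact this

end OPE
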